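/- Let e : A → C be a canonical extension of a bounded lattice A, and let f : A → A satisfy f(a ⊔ b) = f(a) ⊔ f(b) for all a, b ∈ A. Let ◇f : A → A be the normalization of f, defined by ◇f(⊥) = ⊥ and ◇f(a) = f(a) for a ≠ ⊥. Then taking normalizations commutes with taking σ-extensions: for every u ∈ C, (◇f)^σ(u) = ⊥ if u = ⊥, and (◇f)^σ(u) = f^σ(u) if u ≠ ⊥; that is, (◇f)^σ equals the normalization of f^σ. -/

import Mathlib

/-- `e : A → C` realizes the complete lattice `C` as a canonical extension of the
bounded lattice `A`. -/
structure IsCanonicalExtension {A C : Type*} [Lattice A] [BoundedOrder A]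
    [CompleteLattice C] (e : A → C) : Prop where
  injective : Function.Injective e
  map_inf : ∀ a b : A, e (a ⊓ b) = e a ⊓ e b
  map_sup : ∀ a b : A, e (a ⊔ b) = e a ⊔ e b
  map_bot : e ⊥ = ⊥
  map_top : e ⊤ = ⊤
  dense_sup : ∀ u : C, ∃ 𝒮 : Set (Set A), u = ⨆ S ∈ 𝒮, ⨅ a ∈ S, e a
  dense_inf : ∀ u : C, ∃ 𝒮 : Set (Set A), u = ⨅ S ∈ 𝒮, ⨆ a ∈ S, e a
  compact : ∀ S T : Set A, (⨆ a ∈ S, e a) ≤ (⨅ a ∈ T, e a) →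
      ∃ S' T' : Finset A, (S' : Set A) ⊆ S ∧ (T' : Set A) ⊆ T ∧
        (⨆ a ∈ S', e a) ≤ ⨅ a ∈ T', e a

/-- `k ∈ C` is a closed element (a meet of elements of the image of `e`). -/
def IsClosedElem {A C : Type*} [CompleteLattice C] (e : A → C) (k : C) : Prop :=
  ∃ S : Set A, k = ⨅ a ∈ S, e a

/-- The σ-extension of `h : A → A` to the canonical extension:
`h^σ(u) = ⨆ { ⨅ { e(h(a)) | a ∈ A, k ≤ e(a) } | k closed, k ≤ u }`. -/
def sigmaExt {A C : Type*} [CompleteLattice C] (e : A → C) (h : A → A) (u : C) : C :=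
  ⨆ k ∈ {k : C | IsClosedElem e k ∧ k ≤ u}, ⨅ a ∈ {a : A | k ≤ e a}, e (h a)

theorem IsCanonicalExtension.exists_closed_ne_bot {A C : Type*} [Lattice A] [BoundedOrder A]
    [CompleteLattice C] {e : A → C} (he : IsCanonicalExtension e) {u : C} (hu : u ≠ ⊥) :
    ∃ k, IsClosedElem e k ∧ k ≤ u ∧ k ≠ ⊥ := by
  by_contra! h
  obtain ⟨𝒮, h𝒮⟩ := he.dense_sup u
  refine hu (le_bot_iff.mp (h𝒮.le.trans (iSup₂_le fun S hS => ?_)))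
  refine (h _ ⟨S, rfl⟩ ?_).le
  rw [h𝒮]
  exact le_iSup₂_of_le S hS le_rfl

theorem iInf_normalization_eq {A C : Type*} [Lattice A] [BoundedOrder A]
    [CompleteLattice C] {e : A → C} (he : IsCanonicalExtension e) {f Df : A → A}
    (hDf : ∀ a : A, a ≠ ⊥ → Df a = f a) {k : C} (hk : k ≠ ⊥) :
    ⨅ a ∈ {a : A | k ≤ e a}, e (Df a) = ⨅ a ∈ {a : A | k ≤ e a}, e (f a) := by
  refine iInf_congr fun a => iInf_congr fun ha => ?_
  rw [hDf a]
  rintro rfl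
  exact hk (le_bot_iff.mp (he.map_bot ▸ ha))

theorem iInf_normalization_bot {A C : Type*} [Lattice A] [BoundedOrder A]
    [CompleteLattice C] {e : A → C} (he : IsCanonicalExtension e) {Df : A → A}
    (hDf_bot : Df ⊥ = ⊥) :
    ⨅ a ∈ {a : A | (⊥ : C) ≤ e a}, e (Df a) = ⊥ :=
  le_bot_iff.mp (iInf₂_le_of_le ⊥ (Set.mem_ofPred.mpr bot_le) (by rw [hDf_bot, he.map_bot]))

/-- Taking normalizations commutes with taking σ-extensions: if `f` preserves
binary joins and `◇f` is its normalization, then `(◇f)^σ` is the normalization of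
`f^σ`, i.e. `(◇f)^σ(⊥) = ⊥` and `(◇f)^σ(u) = f^σ(u)` for `u ≠ ⊥`. -/
theorem sigmaExt_normalization {A C : Type*} [Lattice A] [BoundedOrder A]
    [CompleteLattice C] (e : A → C) (he : IsCanonicalExtension e)
    (f Df : A → A) (hf : ∀ a b : A, f (a ⊔ b) = f a ⊔ f b)
    (hDf_bot : Df ⊥ = ⊥) (hDf : ∀ a : A, a ≠ ⊥ → Df a = f a) :
    ∀ u : C, (u = ⊥ → sigmaExt e Df u = ⊥) ∧ (u ≠ ⊥ → sigmaExt e Df u = sigmaExt e f u) := by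
  intro u
  constructor
  · rintro rfl
    refine le_bot_iff.mp (iSup₂_le fun k hk => ?_)
    rw [le_bot_iff.mp hk.2]
    exact (iInf_normalization_bot he hDf_bot).le
  · intro hu
    apply le_antisymm
    · refine iSup₂_le fun k hk => ?_
      rcases eq_or_ne k ⊥ with rfl | hk0
      · exact (iInf_normalization_bot he hDf_bot).le.trans bot_le
      · rw [iInf_normalization_eq he hDf hk0]
        exact le_iSup₂_of_le k hk le_rfl
    · refine iSup₂_le fun k hk => ?_
      rcases eq_or_ne k ⊥ with rfl | hk0
      · obtain ⟨k', hk'c, hk'u, hk'0⟩ := he.exists_closed_ne_bot hu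
        refine le_iSup₂_of_le k' ⟨hk'c, hk'u⟩ ?_
        rw [iInf_normalization_eq he hDf hk'0]
        exact biInf_mono fun _ _ => Set.mem_ofPred.mpr bot_le
      · rw [← iInf_normalization_eq he hDf hk0]
        exact le_iSup₂_of_le k hk le_rfl
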